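/- Fix R>0 and α ∈ (1,8). There exists a constant c>0 such that for every δ ∈ (0,1] and every integer k ≥ 2, Σ ∏_{j=1}^k ( (1/2) min_{p≠j} |x_p − x_j| )^{−α/8} ≤ c^k δ^{−2k} k^{kα/16}, where the sum ranges over all k-tuples (x_1,…,x_k) of pairwise distinct points of δℤ² ∩ B(0,R), and B(0,R) is the Euclidean ball of radius R centered at the origin in ℝ². -/

import Mathlib

open scoped Classical

noncomputable section

/-- Vertices of the square lattice (the lattice `δℤ²` is represented by integer
coordinates, the point `p` standing for `δ·p ∈ ℝ²`). -/
abbrev V2 := ℤ × ℤ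

/-- Euclidean distance between the points `δ·p` and `δ·q` of `δℤ² ⊂ ℝ²`. -/
def edist2 (δ : ℝ) (p q : V2) : ℝ :=
  Real.sqrt ((δ * (p.1 : ℝ) - δ * (q.1 : ℝ)) ^ 2 + (δ * (p.2 : ℝ) - δ * (q.2 : ℝ)) ^ 2)

/-- The points of `δℤ²` lying in the (closed) Euclidean ball `B(0,R)` of `ℝ²`. -/
def ballLat (δ R : ℝ) : Finset V2 :=
  ((Finset.Icc (-⌈R / δ⌉) ⌈R / δ⌉) ×ˢ (Finset.Icc (-⌈R / δ⌉) ⌈R / δ⌉)).filter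
    fun p => (δ * (p.1 : ℝ)) ^ 2 + (δ * (p.2 : ℝ)) ^ 2 ≤ R ^ 2

open Finset in
/-- Summing out the coordinates one at a time: each coordinate contributes at most
`#S + n * M` when `w` has column sums at most `M` on `S`. -/
theorem sum_piFinset_prod_one_add_sum_gt_le {T : Type*} (S : Finset T) (w : T → T → ℝ)
    (hw : ∀ p q, 0 ≤ w p q) {M A : ℝ} (hM : 0 ≤ M)
    (hs : ∀ p, ∑ q ∈ S, w p q ≤ M) (n : ℕ) (hA : (#S : ℝ) + n * M ≤ A) :
    ∑ x ∈ Fintype.piFinset (fun _ : Fin n => S),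
      ∏ j, (1 + ∑ i, if j < i then w (x i) (x j) else 0) ≤ A ^ n := by
  induction n with
  | zero => simp
  | succ n ih =>
    have hA' : (#S : ℝ) + n * M ≤ A := by push_cast at hA; linarith
    have hA0 : 0 ≤ A := le_trans (by positivity) hA
    have key : ∑ x ∈ Fintype.piFinset (fun _ : Fin (n + 1) => S),
        ∏ j, (1 + ∑ i, if j < i then w (x i) (x j) else 0) =
        ∑ z ∈ Fintype.piFinset (fun _ : Fin n => S) ×ˢ S,
          (1 + ∑ i, w (z.1 i) z.2) *
            ∏ j, (1 + ∑ i, if j < i then w (z.1 i) (z.1 j) else 0) := by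
      refine Finset.sum_bij' (fun x _ => (Fin.tail x, x 0)) (fun z _ => Fin.cons z.2 z.1)
        ?_ ?_ ?_ ?_ ?_
      · intro x hx
        simp only [Fintype.mem_piFinset, mem_product] at hx ⊢
        exact ⟨fun i => hx _, hx _⟩
      · intro z hz
        simp only [Fintype.mem_piFinset, mem_product] at hz ⊢
        exact Fin.cases (by simpa using hz.2) (by simpa using hz.1)
      · intro x _
        exact Fin.cons_self_tail x
      · intro z _
        simp
      · intro x _
        rw [Fin.prod_univ_succ]
        simp [Fin.sum_univ_succ, Fin.tail]
    rw [key, sum_product, pow_succ']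
    refine le_trans (sum_le_sum (g := fun x : Fin n → T =>
      A * ∏ j, (1 + ∑ i, if j < i then w (x i) (x j) else 0)) fun x _ => ?_) ?_
    · dsimp only
      rw [← sum_mul]
      refine mul_le_mul_of_nonneg_right ?_ (prod_nonneg fun j _ => ?_)
      · rw [sum_add_distrib, sum_comm]
        have h1 : ∑ i, ∑ q ∈ S, w (x i) q ≤ ∑ _i : Fin n, M := sum_le_sum fun i _ => hs _
        simp only [sum_const, card_univ, Fintype.card_fin, nsmul_eq_mul, mul_one] at h1 ⊢
        linarith
      · refine add_nonneg zero_le_one (sum_nonneg fun i _ => ?_)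
        split_ifs
        exacts [hw _ _, le_rfl]
    · rw [← mul_sum]
      exact mul_le_mul_of_nonneg_left (ih hA') hA0

open Finset in
theorem sum_piFinset_prod_one_add_sum_lt_le {T : Type*} (S : Finset T) (w : T → T → ℝ)
    (hw : ∀ p q, 0 ≤ w p q) {M A : ℝ} (hM : 0 ≤ M)
    (hs : ∀ p, ∑ q ∈ S, w p q ≤ M) (n : ℕ) (hA : (#S : ℝ) + n * M ≤ A) :
    ∑ x ∈ Fintype.piFinset (fun _ : Fin n => S),
      ∏ j, (1 + ∑ i, if i < j then w (x i) (x j) else 0) ≤ A ^ n := by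
  refine le_trans (le_of_eq ?_) (sum_piFinset_prod_one_add_sum_gt_le S w hw hM hs n hA)
  refine Finset.sum_bij' (fun x _ => x ∘ Fin.rev) (fun x _ => x ∘ Fin.rev) ?_ ?_ ?_ ?_ ?_
  · intro x hx
    simp only [Fintype.mem_piFinset] at hx ⊢
    exact fun i => hx _
  · intro x hx
    simp only [Fintype.mem_piFinset] at hx ⊢
    exact fun i => hx _
  · intro x _
    ext i
    simp
  · intro x _
    ext i
    simp
  · intro x _
    refine Fintype.prod_equiv Fin.revPerm _ _ fun j => ?_
    congr 1
    refine Fintype.sum_equiv Fin.revPerm _ _ fun i => ?_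
    simp

theorem rpow_neg_le_rpow_sub_rpow {b : ℝ} (hb0 : 0 < b) (hb1 : b < 1) (n : ℕ) :
    ((n : ℝ) + 1) ^ (-b) ≤ (1 / (1 - b)) * (((n : ℝ) + 1) ^ (1 - b) - (n : ℝ) ^ (1 - b)) := by
  have hn : (0 : ℝ) < (n : ℝ) + 1 := by positivity
  have h := rpow_one_add_le_one_add_mul_self (s := -(1 / ((n : ℝ) + 1))) (p := 1 - b)
    (by rw [neg_le_neg_iff, div_le_one hn]; linarith [(Nat.cast_nonneg n : (0 : ℝ) ≤ n)])
    (by linarith) (by linarith)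
  have e1 : (n : ℝ) = ((n : ℝ) + 1) * (1 + -(1 / ((n : ℝ) + 1))) := by field_simp; ring
  have e0 : 0 ≤ 1 + -(1 / ((n : ℝ) + 1)) := by
    have : 1 / ((n : ℝ) + 1) ≤ 1 := by
      rw [div_le_one hn]; linarith [(Nat.cast_nonneg n : (0 : ℝ) ≤ n)]
    linarith
  have e2 : (n : ℝ) ^ (1 - b) =
      ((n : ℝ) + 1) ^ (1 - b) * (1 + -(1 / ((n : ℝ) + 1))) ^ (1 - b) := by
    conv_lhs => rw [e1]
    exact Real.mul_rpow hn.le e0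
  have e3 : ((n : ℝ) + 1) ^ (1 - b) = ((n : ℝ) + 1) * ((n : ℝ) + 1) ^ (-b) := by
    rw [show 1 - b = 1 + -b by ring, Real.rpow_add hn, Real.rpow_one]
  have hb : 0 < 1 - b := by linarith
  rw [one_div, inv_mul_eq_div, le_div_iff₀ hb, e2]
  have h2 := mul_le_mul_of_nonneg_left h (Real.rpow_nonneg hn.le (1 - b))
  have e4 : ((n : ℝ) + 1) ^ (1 - b) * (1 + (1 - b) * -(1 / ((n : ℝ) + 1))) =
      ((n : ℝ) + 1) ^ (1 - b) - (1 - b) * ((n : ℝ) + 1) ^ (-b) := by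
    rw [e3]; field_simp; ring
  linarith

theorem sum_Icc_max_abs_rpow_neg_le {b : ℝ} (hb0 : 0 < b) (hb1 : b < 1) (c : ℤ) (L : ℕ) :
    ∑ a ∈ Finset.Icc (c - L) (c + L), (max |((a - c : ℤ) : ℝ)| 1) ^ (-b) ≤
      1 + 2 / (1 - b) * (L : ℝ) ^ (1 - b) := by
  induction L with
  | zero =>
    have : 1 - b ≠ 0 := by linarith
    simp [this]
  | succ n ih =>
    have hI : Finset.Icc (c - ((n + 1 : ℕ) : ℤ)) (c + ((n + 1 : ℕ) : ℤ)) =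
        insert (c - (n + 1 : ℤ)) (insert (c + (n + 1 : ℤ)) (Finset.Icc (c - n) (c + n))) := by
      ext a
      simp only [Finset.mem_Icc, Finset.mem_insert]
      push_cast
      omega
    have hn : (0 : ℝ) ≤ n := Nat.cast_nonneg n
    rw [hI, Finset.sum_insert, Finset.sum_insert]
    · have h := rpow_neg_le_rpow_sub_rpow hb0 hb1 n
      have t1 : max |((c - (n + 1 : ℤ) - c : ℤ) : ℝ)| 1 = (n : ℝ) + 1 := by
        have : ((c - (n + 1 : ℤ) - c : ℤ) : ℝ) = -((n : ℝ) + 1) := by push_cast; ring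
        rw [this, abs_neg, abs_of_nonneg (by linarith), max_eq_left (by linarith)]
      have t2 : max |((c + (n + 1 : ℤ) - c : ℤ) : ℝ)| 1 = (n : ℝ) + 1 := by
        have : ((c + (n + 1 : ℤ) - c : ℤ) : ℝ) = (n : ℝ) + 1 := by push_cast; ring
        rw [this, abs_of_nonneg (by linarith), max_eq_left (by linarith)]
      rw [t1, t2, Nat.cast_succ]
      have e : 2 / (1 - b) = 2 * (1 / (1 - b)) := by ring
      rw [e] at ih ⊢
      linarith
    · simp
    · simp
      omega

theorem edist2_eq_mul_sqrt {δ : ℝ} (hδ : 0 < δ) (p q : V2) :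
    edist2 δ p q = δ * √(((q.1 - p.1 : ℤ) : ℝ) ^ 2 + ((q.2 - p.2 : ℤ) : ℝ) ^ 2) := by
  unfold edist2
  rw [show (δ * (p.1 : ℝ) - δ * (q.1 : ℝ)) ^ 2 + (δ * (p.2 : ℝ) - δ * (q.2 : ℝ)) ^ 2 =
    δ ^ 2 * (((q.1 - p.1 : ℤ) : ℝ) ^ 2 + ((q.2 - p.2 : ℤ) : ℝ) ^ 2) by push_cast; ring,
    Real.sqrt_mul (sq_nonneg δ), Real.sqrt_sq hδ.le]

theorem one_le_sqrt_of_ne {p q : V2} (h : p ≠ q) :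
    1 ≤ √(((q.1 - p.1 : ℤ) : ℝ) ^ 2 + ((q.2 - p.2 : ℤ) : ℝ) ^ 2) := by
  rw [Real.one_le_sqrt]
  have : 1 ≤ (q.1 - p.1) ^ 2 + (q.2 - p.2) ^ 2 := by
    by_contra hlt
    have h1 : (q.1 - p.1) ^ 2 = 0 := by nlinarith [sq_nonneg (q.1 - p.1), sq_nonneg (q.2 - p.2)]
    have h2 : (q.2 - p.2) ^ 2 = 0 := by nlinarith [sq_nonneg (q.1 - p.1), sq_nonneg (q.2 - p.2)]
    apply h
    ext
    · linarith [pow_eq_zero_iff (two_ne_zero) |>.1 h1]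
    · linarith [pow_eq_zero_iff (two_ne_zero) |>.1 h2]
  exact_mod_cast this

theorem edist2_pos {δ : ℝ} (hδ : 0 < δ) {p q : V2} (h : p ≠ q) : 0 < edist2 δ p q := by
  rw [edist2_eq_mul_sqrt hδ]
  exact mul_pos hδ (lt_of_lt_of_le one_pos (one_le_sqrt_of_ne h))

/-- The squared inverse-distance weight, rescaled by `r` and truncated at distance `1 / r`. -/
def nearWeight (δ r b : ℝ) (p q : V2) : ℝ :=
  if r * edist2 δ p q < 1 then (r * edist2 δ p q) ^ (-(2 * b)) else 0

theorem nearWeight_nonneg {δ r : ℝ} (hr : 0 < r) (b : ℝ) (p q : V2) :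
    0 ≤ nearWeight δ r b p q := by
  unfold nearWeight
  split_ifs
  · exact Real.rpow_nonneg (mul_nonneg hr.le (Real.sqrt_nonneg _)) _
  · exact le_rfl

theorem nearWeight_self {δ r b : ℝ} (hb : 0 < b) (p : V2) : nearWeight δ r b p p = 0 := by
  have : -(2 * b) ≠ 0 := by linarith
  simp [nearWeight, edist2, Real.zero_rpow this]

theorem sum_nearWeight_le {δ r b : ℝ} (hδ : 0 < δ) (hr : 0 < r) (hb0 : 0 < b) (hb1 : b < 1)
    (S : Finset V2) (p : V2) :
    ∑ q ∈ S, nearWeight δ r b p q ≤ (1 + 2 / (1 - b)) ^ 2 * (1 / (r * δ)) ^ 2 := by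
  set N : ℝ := 1 / (r * δ) with hN
  have hN0 : 0 < N := by positivity
  have hrδ : r * δ = 1 / N := by rw [hN, one_div_one_div]
  have hw : ∀ q, r * edist2 δ p q =
      √(((q.1 - p.1 : ℤ) : ℝ) ^ 2 + ((q.2 - p.2 : ℤ) : ℝ) ^ 2) / N := by
    intro q
    rw [edist2_eq_mul_sqrt hδ, ← mul_assoc, hrδ]; ring
  have hs : 0 < 1 - b := by linarith
  by_cases hN1 : N < 1
  · refine le_trans (le_of_eq (Finset.sum_eq_zero fun q _ => ?_)) (by positivity)
    by_cases hpq : p = q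
    · rw [← hpq, nearWeight_self hb0]
    · unfold nearWeight
      rw [if_neg]
      rw [hw, not_lt, le_div_iff₀ hN0]
      linarith [one_le_sqrt_of_ne hpq]
  push Not at hN1
  set L : ℕ := ⌊N⌋₊ with hL
  have hLN : (L : ℝ) ≤ N := Nat.floor_le hN0.le
  let g : ℤ → ℝ := fun a => (max |(a : ℝ)| 1) ^ (-b)
  have hg : ∀ a, 0 ≤ g a := fun a => Real.rpow_nonneg (le_max_of_le_right zero_le_one) _
  let B : Finset V2 := Finset.Icc (p.1 - L) (p.1 + L) ×ˢ Finset.Icc (p.2 - L) (p.2 + L)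
  have hpt : ∀ q, nearWeight δ r b p q ≠ 0 →
      q ∈ B ∧ nearWeight δ r b p q ≤ N ^ (2 * b) * (g (q.1 - p.1) * g (q.2 - p.2)) := by
    intro q hq
    have hpq : p ≠ q := by
      rintro rfl
      exact hq (nearWeight_self hb0 p)
    unfold nearWeight at hq ⊢
    have hlt : r * edist2 δ p q < 1 := by
      by_contra hc
      exact hq (if_neg hc)
    rw [if_pos hlt]
    rw [hw] at hlt ⊢
    have h1 := one_le_sqrt_of_ne hpq
    set ρ := √(((q.1 - p.1 : ℤ) : ℝ) ^ 2 + ((q.2 - p.2 : ℤ) : ℝ) ^ 2) with hρ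
    have hρN : ρ < N := by rwa [div_lt_one hN0] at hlt
    have ha : |((q.1 - p.1 : ℤ) : ℝ)| ≤ ρ :=
      Real.abs_le_sqrt (le_add_of_nonneg_right (sq_nonneg _))
    have hb : |((q.2 - p.2 : ℤ) : ℝ)| ≤ ρ :=
      Real.abs_le_sqrt (le_add_of_nonneg_left (sq_nonneg _))
    have hbox : ∀ a : ℤ, |(a : ℝ)| ≤ ρ → |a| ≤ (L : ℤ) := by
      intro a h
      have h3 : ((a.natAbs : ℕ) : ℝ) ≤ N := by
        rw [Nat.cast_natAbs, Int.cast_abs]; linarith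
      have := Nat.le_floor h3
      rw [Int.abs_eq_natAbs]
      exact_mod_cast this
    refine ⟨?_, ?_⟩
    · have h3 := abs_le.1 (hbox _ ha)
      have h4 := abs_le.1 (hbox _ hb)
      simp only [B, Finset.mem_product, Finset.mem_Icc]
      omega
    · have hρ0 : 0 < ρ := by linarith
      have e : (ρ / N) ^ (-(2 * b)) = N ^ (2 * b) * (ρ ^ (-b) * ρ ^ (-b)) := by
        rw [← Real.rpow_add hρ0, Real.div_rpow hρ0.le hN0.le, Real.rpow_neg hN0.le, div_inv_eq_mul,
          mul_comm]
        congr 2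
        ring
      rw [e]
      refine mul_le_mul_of_nonneg_left ?_ (Real.rpow_nonneg hN0.le _)
      have hm : ∀ a : ℤ, |(a : ℝ)| ≤ ρ → ρ ^ (-b) ≤ g a := fun a h =>
        Real.rpow_le_rpow_of_nonpos (lt_max_of_lt_right one_pos) (max_le h h1) (by linarith)
      exact mul_le_mul (hm _ ha) (hm _ hb) (Real.rpow_nonneg hρ0.le _) (hg _)
  have hG : ∀ c : ℤ, ∑ a ∈ Finset.Icc (c - L) (c + L), g (a - c) ≤
      (1 + 2 / (1 - b)) * N ^ (1 - b) := by
    intro c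
    refine (sum_Icc_max_abs_rpow_neg_le hb0 hb1 c L).trans ?_
    have h1 : (1 : ℝ) ≤ N ^ (1 - b) := Real.one_le_rpow hN1 hs.le
    have h2 : (L : ℝ) ^ (1 - b) ≤ N ^ (1 - b) :=
      Real.rpow_le_rpow (Nat.cast_nonneg _) hLN hs.le
    rw [add_mul, one_mul]
    exact add_le_add h1 (mul_le_mul_of_nonneg_left h2 (by positivity))
  calc ∑ q ∈ S, nearWeight δ r b p q
      = ∑ q ∈ S with nearWeight δ r b p q ≠ 0, nearWeight δ r b p q :=
        (Finset.sum_filter_ne_zero S).symm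
    _ ≤ ∑ q ∈ S with nearWeight δ r b p q ≠ 0,
          N ^ (2 * b) * (g (q.1 - p.1) * g (q.2 - p.2)) :=
        Finset.sum_le_sum fun q hq => (hpt q (Finset.mem_filter.1 hq).2).2
    _ ≤ ∑ q ∈ B, N ^ (2 * b) * (g (q.1 - p.1) * g (q.2 - p.2)) :=
        Finset.sum_le_sum_of_subset_of_nonneg
          (fun q hq => (hpt q (Finset.mem_filter.1 hq).2).1)
          fun q _ _ => mul_nonneg (Real.rpow_nonneg hN0.le _) (mul_nonneg (hg _) (hg _))
    _ = N ^ (2 * b) * ((∑ a ∈ Finset.Icc (p.1 - L) (p.1 + L), g (a - p.1)) *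
          ∑ a ∈ Finset.Icc (p.2 - L) (p.2 + L), g (a - p.2)) := by
        rw [← Finset.mul_sum, Finset.sum_mul_sum, Finset.sum_product]
    _ ≤ N ^ (2 * b) * (((1 + 2 / (1 - b)) * N ^ (1 - b)) * ((1 + 2 / (1 - b)) * N ^ (1 - b))) := by
        refine mul_le_mul_of_nonneg_left ?_ (Real.rpow_nonneg hN0.le _)
        exact mul_le_mul (hG _) (hG _) (Finset.sum_nonneg fun a _ => hg _) (by positivity)
    _ = (1 + 2 / (1 - b)) ^ 2 * N ^ 2 := by
        have : N ^ 2 = N ^ (2 * b) * (N ^ (1 - b) * N ^ (1 - b)) := by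
          rw [← Real.rpow_add hN0, ← Real.rpow_add hN0, ← Real.rpow_natCast]
          congr 1
          push_cast
          ring
        rw [this]
        ring

theorem card_ballLat_le {δ R : ℝ} (hR : 0 < R) (hδ : 0 < δ) (hδ1 : δ ≤ 1) :
    ((ballLat δ R).card : ℝ) ≤ (2 * R + 3) ^ 2 * (1 / δ) ^ 2 := by
  have h1 : (ballLat δ R).card ≤ ((2 * ⌈R / δ⌉ + 1).toNat) ^ 2 := by
    refine (Finset.card_filter_le _ _).trans (le_of_eq ?_)
    rw [Finset.card_product, Int.card_Icc, sq]
    congr 2 <;> ring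
  have h0 : 0 ≤ ⌈R / δ⌉ := Int.ceil_nonneg (by positivity)
  have h2 : (((2 * ⌈R / δ⌉ + 1).toNat : ℕ) : ℝ) = 2 * (⌈R / δ⌉ : ℝ) + 1 := by
    have : (((2 * ⌈R / δ⌉ + 1).toNat : ℕ) : ℤ) = 2 * ⌈R / δ⌉ + 1 := Int.toNat_of_nonneg (by omega)
    exact_mod_cast congrArg (Int.cast : ℤ → ℝ) this
  have h3 : (⌈R / δ⌉ : ℝ) < R / δ + 1 := Int.ceil_lt_add_one _
  have h4 : (1 : ℝ) ≤ 1 / δ := by rwa [one_le_div hδ]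
  have h5 : 2 * (⌈R / δ⌉ : ℝ) + 1 ≤ (2 * R + 3) * (1 / δ) := by
    have : (2 * R + 3) * (1 / δ) = 2 * (R / δ) + 3 * (1 / δ) := by ring
    linarith
  calc ((ballLat δ R).card : ℝ) ≤ (((2 * ⌈R / δ⌉ + 1).toNat : ℕ) : ℝ) ^ 2 := by exact_mod_cast h1
    _ ≤ ((2 * R + 3) * (1 / δ)) ^ 2 := by
      rw [h2]
      have : (0 : ℝ) ≤ (⌈R / δ⌉ : ℝ) := by exact_mod_cast h0
      exact pow_le_pow_left₀ (by linarith) h5 2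
    _ = _ := by ring

/-- The nearest-neighbour factor is controlled by the weights of earlier and of later indices. -/
theorem half_iInf_edist2_rpow_le {δ r b : ℝ} (hδ : 0 < δ) (hr : 0 < r) (hb0 : 0 < b) (hb1 : b < 1)
    {k : ℕ} (hk : 2 ≤ k) {x : Fin k → V2} (hx : Function.Injective x) (j : Fin k) :
    ((1 / 2 : ℝ) * ⨅ p : { p : Fin k // p ≠ j }, edist2 δ (x ↑p) (x j)) ^ (-b) ≤
      2 * r ^ b * √((1 + ∑ i, if j < i then nearWeight δ r b (x i) (x j) else 0) *
        (1 + ∑ i, if i < j then nearWeight δ r b (x i) (x j) else 0)) := by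
  have hnt : Nontrivial (Fin k) := Fin.nontrivial_iff_two_le.2 hk
  obtain ⟨i₀, hi₀⟩ := exists_ne j
  have : Nonempty { p : Fin k // p ≠ j } := ⟨⟨i₀, hi₀⟩⟩
  obtain ⟨⟨p, hp⟩, hpe⟩ := exists_eq_ciInf_of_finite
    (f := fun p : { p : Fin k // p ≠ j } => edist2 δ (x ↑p) (x j))
  rw [← hpe]
  change ((1 / 2 : ℝ) * edist2 δ (x p) (x j)) ^ (-b) ≤ _
  have hd : 0 < edist2 δ (x p) (x j) := edist2_pos hδ fun h => hp (hx h)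
  set d := edist2 δ (x p) (x j) with hd_def
  have e : ((1 / 2 : ℝ) * d) ^ (-b) = 2 ^ b * r ^ b * (r * d) ^ (-b) := by
    rw [Real.mul_rpow (by norm_num) hd.le, Real.mul_rpow hr.le hd.le, one_div,
      Real.inv_rpow (by norm_num), Real.rpow_neg (by norm_num), inv_inv, Real.rpow_neg hr.le]
    have := (Real.rpow_pos_of_pos hr b).ne'
    field_simp
  have h2 : (2 : ℝ) ^ b ≤ 2 := by
    simpa using Real.rpow_le_rpow_of_exponent_le (one_le_two (α := ℝ)) hb1.le
  rw [e]
  have hnn : ∀ i, 0 ≤ nearWeight δ r b (x i) (x j) := fun i => nearWeight_nonneg hr _ _ _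
  have hgt0 : ∀ i, 0 ≤ (if j < i then nearWeight δ r b (x i) (x j) else 0) := fun i => by
    split_ifs
    exacts [hnn i, le_rfl]
  have hlt0 : ∀ i, 0 ≤ (if i < j then nearWeight δ r b (x i) (x j) else 0) := fun i => by
    split_ifs
    exacts [hnn i, le_rfl]
  have hgtS := Finset.sum_nonneg fun i (_ : i ∈ Finset.univ) => hgt0 i
  have hltS := Finset.sum_nonneg fun i (_ : i ∈ Finset.univ) => hlt0 i
  have hgt1 := Finset.single_le_sum (fun i _ => hgt0 i) (Finset.mem_univ p)
  have hlt1 := Finset.single_le_sum (fun i _ => hlt0 i) (Finset.mem_univ p)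
  have hrd : 0 < r * d := mul_pos hr hd
  have hmain : (r * d) ^ (-b) ≤
      √((1 + ∑ i, if j < i then nearWeight δ r b (x i) (x j) else 0) *
        (1 + ∑ i, if i < j then nearWeight δ r b (x i) (x j) else 0)) := by
    apply Real.le_sqrt_of_sq_le
    by_cases h1 : r * d < 1
    · have hsq : ((r * d) ^ (-b)) ^ 2 = nearWeight δ r b (x p) (x j) := by
        unfold nearWeight
        rw [if_pos h1, ← Real.rpow_natCast, ← Real.rpow_mul hrd.le]
        congr 1
        push_cast
        ring
      rw [hsq]
      rcases lt_or_gt_of_ne hp with h | h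
      · rw [if_pos h] at hlt1
        nlinarith
      · rw [if_pos h] at hgt1
        nlinarith
    · push Not at h1
      have : (r * d) ^ (-b) ≤ 1 := Real.rpow_le_one_of_one_le_of_nonpos h1 (by linarith)
      have h0 : 0 ≤ (r * d) ^ (-b) := Real.rpow_nonneg hrd.le _
      nlinarith
  have hrb := Real.rpow_nonneg hr.le b
  gcongr

/-- Fix `R > 0` and `α ∈ (1,8)`. There is a constant `c > 0` such
that for every `δ ∈ (0,1]` and every `k ≥ 2`,
`Σ ∏_{j=1}^k ((1/2) min_{p≠j} |x_p − x_j|)^{−α/8} ≤ c^k δ^{−2k} k^{kα/16}`,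
the sum ranging over `k`-tuples of pairwise distinct points of `δℤ² ∩ B(0,R)`. -/
theorem tuple_sum_inverse_distance_bound
    (R : ℝ) (hR : 0 < R) (α : ℝ) (hα1 : 1 < α) (hα8 : α < 8) :
    ∃ c : ℝ, 0 < c ∧
      ∀ (δ : ℝ), 0 < δ → δ ≤ 1 → ∀ (k : ℕ), 2 ≤ k →
        ∑ x ∈ (Fintype.piFinset fun _ : Fin k => ballLat δ R).filter
            (fun x => Function.Injective x),
          ∏ j : Fin k,
            ((1 / 2 : ℝ) * ⨅ p : { p : Fin k // p ≠ j }, edist2 δ (x ↑p) (x j)) ^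
              (-(α / 8)) ≤
        c ^ k * δ ^ (-(2 * (k : ℝ))) * (k : ℝ) ^ ((k : ℝ) * α / 16) := by
  have hb0 : 0 < α / 8 := by linarith
  have hb1 : α / 8 < 1 := by linarith
  set b := α / 8 with hb
  set C : ℝ := (2 * R + 3) ^ 2 + (1 + 2 / (1 - b)) ^ 2 with hC
  have hC0 : 0 < C := by positivity
  refine ⟨2 * C, by positivity, fun δ hδ hδ1 k hk => ?_⟩
  have hk0 : (0 : ℝ) < k := by positivity
  set r : ℝ := √(k : ℝ) with hr_def
  have hr : 0 < r := Real.sqrt_pos.2 hk0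
  have hr2 : r ^ 2 = k := Real.sq_sqrt hk0.le
  set S := ballLat δ R with hS
  let w := nearWeight δ r b
  let P : (Fin k → V2) → ℝ := fun x => ∏ j, (1 + ∑ i, if j < i then w (x i) (x j) else 0)
  let Q : (Fin k → V2) → ℝ := fun x => ∏ j, (1 + ∑ i, if i < j then w (x i) (x j) else 0)
  have hw : ∀ p q, 0 ≤ w p q := nearWeight_nonneg hr b
  have hone : ∀ (s : Fin k → Prop) [DecidablePred s] (x : Fin k → V2) (j : Fin k),
      0 ≤ 1 + ∑ i, if s i then w (x i) (x j) else 0 := fun s _ x j => by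
    refine add_nonneg zero_le_one (Finset.sum_nonneg fun i _ => ?_)
    split_ifs
    exacts [hw _ _, le_rfl]
  have hP : ∀ x, 0 ≤ P x := fun x => Finset.prod_nonneg fun j _ => hone (j < ·) x j
  have hQ : ∀ x, 0 ≤ Q x := fun x => Finset.prod_nonneg fun j _ => hone (· < j) x j
  have hM : (S.card : ℝ) + k * ((1 + 2 / (1 - b)) ^ 2 * (1 / (r * δ)) ^ 2) ≤
      C * (1 / δ) ^ 2 := by
    have h1 := card_ballLat_le hR hδ hδ1
    have h2 : (k : ℝ) * ((1 + 2 / (1 - b)) ^ 2 * (1 / (r * δ)) ^ 2) =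
        (1 + 2 / (1 - b)) ^ 2 * (1 / δ) ^ 2 := by
      rw [← hr2]
      field_simp
    rw [h2, hC, add_mul]
    linarith
  have hsP := sum_piFinset_prod_one_add_sum_gt_le S w hw (by positivity)
    (sum_nearWeight_le hδ hr hb0 hb1 S) k hM
  have hsQ := sum_piFinset_prod_one_add_sum_lt_le S w hw (by positivity)
    (sum_nearWeight_le hδ hr hb0 hb1 S) k hM
  have hrb : 0 ≤ r ^ b := Real.rpow_nonneg hr.le b
  have hterm : ∀ x : Fin k → V2, Function.Injective x →
      ∏ j : Fin k, ((1 / 2 : ℝ) * ⨅ p : { p : Fin k // p ≠ j }, edist2 δ (x ↑p) (x j)) ^ (-b) ≤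
        (2 * r ^ b) ^ k * ((P x + Q x) / 2) := by
    intro x hx
    refine (Finset.prod_le_prod (fun j _ => ?_)
      fun j _ => half_iInf_edist2_rpow_le hδ hr hb0 hb1 hk hx j).trans ?_
    · exact Real.rpow_nonneg (mul_nonneg (by norm_num)
        (Real.iInf_nonneg fun _ => Real.sqrt_nonneg _)) _
    · rw [Finset.prod_mul_distrib, Finset.prod_const, Finset.card_univ, Fintype.card_fin,
        ← Real.sqrt_prod _ fun j _ => mul_nonneg (hone (j < ·) x j) (hone (· < j) x j),
        Finset.prod_mul_distrib]
      refine mul_le_mul_of_nonneg_left ?_ (by positivity)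
      change √(P x * Q x) ≤ _
      rw [Real.sqrt_le_left (by linarith [hP x, hQ x])]
      nlinarith [sq_nonneg (P x - Q x)]
  have hsum0 : ∀ x, 0 ≤ (2 * r ^ b) ^ k * ((P x + Q x) / 2) := fun x =>
    mul_nonneg (by positivity) (by linarith [hP x, hQ x])
  calc _ ≤ ∑ x ∈ (Fintype.piFinset fun _ : Fin k => S).filter (fun x => Function.Injective x),
        (2 * r ^ b) ^ k * ((P x + Q x) / 2) :=
        Finset.sum_le_sum fun x hx => hterm x (Finset.mem_filter.1 hx).2
    _ ≤ ∑ x ∈ Fintype.piFinset fun _ : Fin k => S, (2 * r ^ b) ^ k * ((P x + Q x) / 2) :=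
        Finset.sum_le_sum_of_subset_of_nonneg (Finset.filter_subset _ _) fun x _ _ => hsum0 x
    _ = (2 * r ^ b) ^ k * ((∑ x ∈ Fintype.piFinset fun _ : Fin k => S, P x +
          ∑ x ∈ Fintype.piFinset fun _ : Fin k => S, Q x) / 2) := by
        rw [← Finset.mul_sum, ← Finset.sum_div, Finset.sum_add_distrib]
    _ ≤ (2 * r ^ b) ^ k * (C * (1 / δ) ^ 2) ^ k := by
        refine mul_le_mul_of_nonneg_left ?_ (by positivity)
        linarith
    _ = (2 * C) ^ k * δ ^ (-(2 * (k : ℝ))) * (k : ℝ) ^ ((k : ℝ) * α / 16) := by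
        have e1 : δ ^ (-(2 * (k : ℝ))) = ((1 / δ) ^ 2) ^ k := by
          rw [Real.rpow_neg hδ.le, ← pow_mul, one_div, inv_pow, ← Real.rpow_natCast]
          push_cast
          rfl
        have e2 : (k : ℝ) ^ ((k : ℝ) * α / 16) = (r ^ b) ^ k := by
          rw [hr_def, Real.sqrt_eq_rpow, ← Real.rpow_mul hk0.le, ← Real.rpow_mul_natCast hk0.le]
          congr 1
          rw [hb]
          ring
        rw [e1, e2]
        simp only [mul_pow]
        ring

end
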